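/- If leaves(T_i) = 1 for every i (that is, every subtree in 𝒯 is a directed path of the rooted tree T, going from its root down to a single leaf), then the greedy solution is optimal: |ALG| = |OPT|. -/

import Mathlib

/-!
Setting: `G` is a finite tree rooted at `r`. A family `S : Fin n → Finset V` of
vertex sets of subtrees (connected subgraphs) of `G` is given; since connected
subgraphs of a tree are induced, a subtree is faithfully represented by its
vertex set. An *object* of the tree is a vertex or an edge. Capacities are
given by `k`, loads count the subtrees containing an object, feasibility means
no object is overloaded. The subtrees are indexed so that their roots appear
in nondecreasing order along some post-order (bottom-up) traversal of the tree,
which is encoded by an injective numbering `pos` of the vertices such that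
descendants of any vertex `v` appear (contiguously) before `v`.
-/

open Finset

attribute [local instance] Classical.propDecidable

/-- An *object* of a graph on vertex type `V`: a vertex or a (potential) edge. -/
abbrev Object (V : Type) := V ⊕ Sym2 V

/-- The subtree of `G` with vertex set `s` contains the object `o`. -/
def ContainsObj {V : Type} (G : SimpleGraph V) (s : Finset V) : Object V → Prop
  | Sum.inl v => v ∈ s
  | Sum.inr e => e ∈ G.edgeSet ∧ ∀ x ∈ e, x ∈ s

/-- The load induced by the subfamily `U` on the object `o`. -/
noncomputable def load {V : Type} {n : ℕ} (G : SimpleGraph V) (S : Fin n → Finset V)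
    (U : Finset (Fin n)) (o : Object V) : ℕ :=
  (U.filter fun i => ContainsObj G (S i) o).card

/-- A subfamily of subtrees is feasible if it does not overload any object. -/
def Feasible {V : Type} {n : ℕ} (G : SimpleGraph V) (S : Fin n → Finset V)
    (k : Object V → ℕ) (U : Finset (Fin n)) : Prop :=
  ∀ o : Object V, load G S U o ≤ k o

/-- The index set `𝒯_i` of the first `i` subtrees. -/
noncomputable def firstIdx (n i : ℕ) : Finset (Fin n) :=
  univ.filter fun j => (j : ℕ) < i

/-- `ALG_i`: the greedy solution after the first `i` subtrees have been considered. -/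
noncomputable def greedy {V : Type} {n : ℕ} (G : SimpleGraph V) (S : Fin n → Finset V)
    (k : Object V → ℕ) : ℕ → Finset (Fin n)
  | 0 => ∅
  | m + 1 =>
    if h : m < n then
      if Feasible G S k (insert ⟨m, h⟩ (greedy G S k m)) then
        insert ⟨m, h⟩ (greedy G S k m)
      else greedy G S k m
    else greedy G S k m

/-- `v` is an ancestor of `u` in the tree `G` rooted at `r`
(i.e. `v` lies on the unique `r`–`u` path). -/
def IsAnc {V : Type} (G : SimpleGraph V) (r v u : V) : Prop :=
  G.dist r u = G.dist r v + G.dist v u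

/-- The number of leaves of the subtree with vertex set `s` that differ from its root `rt`. -/
noncomputable def leavesCnt {V : Type} [DecidableEq V] (G : SimpleGraph V)
    (s : Finset V) (rt : V) : ℕ :=
  (s.filter fun v => v ≠ rt ∧ (s.filter fun u => G.Adj v u).card ≤ 1).card

theorem aux_F1 {V : Type} {G : SimpleGraph V} (hT : G.IsTree) (r : V) {a b : V} (h : G.Adj a b) :
    G.dist r a = G.dist r b + 1 ∨ G.dist r b = G.dist r a + 1 := by
  have h1 := hT.dist_ne_of_adj r h
  have h2 := hT.connected.dist_triangle (u := r) (v := a) (w := b)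
  have h3 := hT.connected.dist_triangle (u := r) (v := b) (w := a)
  rw [SimpleGraph.dist_eq_one_iff_adj.mpr h] at h2
  rw [SimpleGraph.dist_eq_one_iff_adj.mpr h.symm] at h3
  omega

theorem aux_anc_uniq {V : Type} {G : SimpleGraph V} (hT : G.IsTree) (r : V) {a b u : V}
    (ha : IsAnc G r a u) (hb : IsAnc G r b u) (hab : G.dist r a = G.dist r b) : a = b := by
  unfold IsAnc at ha hb
  obtain ⟨p, hp⟩ := hT.connected.exists_walk_length_eq_dist r a
  obtain ⟨q, hq⟩ := hT.connected.exists_walk_length_eq_dist a u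
  obtain ⟨p', hp'⟩ := hT.connected.exists_walk_length_eq_dist r b
  obtain ⟨q', hq'⟩ := hT.connected.exists_walk_length_eq_dist b u
  have h1 : (p.append q).IsPath := by
    apply SimpleGraph.Walk.isPath_of_length_eq_dist
    rw [SimpleGraph.Walk.length_append]; omega
  have h2 : (p'.append q').IsPath := by
    apply SimpleGraph.Walk.isPath_of_length_eq_dist
    rw [SimpleGraph.Walk.length_append]; omega
  have h3 : p.append q = p'.append q' :=
    congrArg Subtype.val (hT.isAcyclic.path_unique ⟨_, h1⟩ ⟨_, h2⟩)
  have h4 : (p.append q).getVert (G.dist r a) = a := by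
    rw [SimpleGraph.Walk.getVert_append]; simp [hp]
  have h5 : (p'.append q').getVert (G.dist r a) = b := by
    rw [SimpleGraph.Walk.getVert_append]; simp [hp', hab]
  rw [← h4, ← h5, h3]

theorem aux_anc_of_adj {V : Type} {G : SimpleGraph V} (hT : G.IsTree) (r : V) {a u c : V}
    (ha : IsAnc G r a u) (h : G.Adj u c) (hd : G.dist r c = G.dist r u + 1) :
    IsAnc G r a c := by
  unfold IsAnc at *
  have h1 := hT.connected.dist_triangle (u := a) (v := u) (w := c)
  have h2 := hT.connected.dist_triangle (u := r) (v := a) (w := c)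
  rw [SimpleGraph.dist_eq_one_iff_adj.mpr h] at h1
  omega

theorem aux_F2 {V : Type} {G : SimpleGraph V} (hT : G.IsTree) (r : V) {a b u : V}
    (ha : G.Adj a u) (hb : G.Adj b u) (hda : G.dist r u = G.dist r a + 1)
    (hdb : G.dist r u = G.dist r b + 1) : a = b := by
  refine aux_anc_uniq hT r (u := u) ?_ ?_ (by omega)
  · exact aux_anc_of_adj hT r (by simp [IsAnc]) ha hda
  · exact aux_anc_of_adj hT r (by simp [IsAnc]) hb hdb

theorem aux_down {V : Type} {G : SimpleGraph V} (hT : G.IsTree) (r : V) {c b : V}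
    (p : G.Walk c b) : ∀ a, G.Adj a c → p.IsPath → a ∉ p.support →
    G.dist r c = G.dist r a + 1 → G.dist r c ≤ G.dist r b := by
  induction p with
  | nil => intros; exact le_rfl
  | @cons u v w h q ih =>
    intro a hac hp hns hd
    rw [SimpleGraph.Walk.cons_isPath_iff] at hp
    rcases aux_F1 hT r h with h1 | h1
    · exfalso
      have : a = v := aux_F2 hT r hac h.symm hd h1
      subst this
      simp at hns
    · have := ih u h hp.1 hp.2 h1
      omega

theorem aux_F3 {V : Type} {G : SimpleGraph V} (hT : G.IsTree) (r : V) (s : Finset V)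
    (hs : (G.induce (s : Set V)).Connected) (t : V) (ht : t ∈ s)
    (hmin : ∀ v ∈ s, G.dist r t ≤ G.dist r v) (u : V) (hu : u ∈ s) (hut : u ≠ t) :
    ∃ p ∈ s, G.Adj p u ∧ G.dist r u = G.dist r p + 1 := by
  obtain ⟨w, hw⟩ := (hs ⟨u, hu⟩ ⟨t, ht⟩).exists_isPath
  cases w with
  | nil => exact absurd rfl hut
  | @cons _ v _ h q =>
    have hadj : G.Adj u v.1 := by simpa using h
    have hvs : v.1 ∈ s := v.2
    rcases aux_F1 hT r hadj with h1 | h1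
    · exact ⟨v.1, hvs, hadj.symm, h1⟩
    · exfalso
      rw [SimpleGraph.Walk.cons_isPath_iff] at hw
      let f : G.induce (s : Set V) ↪g G := SimpleGraph.Embedding.induce _
      have hq : (q.map f.toHom).IsPath := SimpleGraph.Walk.map_isPath_of_injective f.injective hw.1
      have := aux_down hT r (q.map f.toHom) u hadj hq (by
        rw [SimpleGraph.Walk.support_map]
        intro hm
        obtain ⟨x, hx, hxu⟩ := List.mem_map.1 hm
        have : x = ⟨u, hu⟩ := Subtype.ext hxu
        exact hw.2 (this ▸ hx)) h1
      have h3 := hmin u hu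
      change G.dist r v.1 ≤ G.dist r t at this
      omega

theorem aux_anc_rt {V : Type} {G : SimpleGraph V} (hT : G.IsTree) (r : V) (s : Finset V)
    (hs : (G.induce (s : Set V)).Connected) (t : V) (ht : t ∈ s)
    (hmin : ∀ v ∈ s, G.dist r t ≤ G.dist r v) (d : ℕ) : ∀ u ∈ s, G.dist r u = d →
    IsAnc G r t u := by
  induction d with
  | zero =>
    intro u hu hd
    by_cases hut : u = t
    · simp [hut, IsAnc]
    · obtain ⟨p, _, _, h⟩ := aux_F3 hT r s hs t ht hmin u hu hut
      omega
  | succ d ih =>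
    intro u hu hd
    by_cases hut : u = t
    · simp [hut, IsAnc]
    · obtain ⟨p, hp, ha, h⟩ := aux_F3 hT r s hs t ht hmin u hu hut
      exact aux_anc_of_adj hT r (ih p hp (by omega)) ha h

theorem aux_leaf {V : Type} [DecidableEq V] {G : SimpleGraph V} (hT : G.IsTree) (r : V)
    (s : Finset V) (u : V) (hu : u ∈ s) :
    ∃ x ∈ s, IsAnc G r u x ∧ (s.filter fun y => G.Adj x y).card ≤ 1 := by
  obtain ⟨x, hx, hmax⟩ := Finset.exists_max_image (s.filter fun x => IsAnc G r u x)
    (fun x => G.dist r x) ⟨u, Finset.mem_filter.2 ⟨hu, by simp [IsAnc]⟩⟩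
  simp only [Finset.mem_filter] at hx hmax
  refine ⟨x, hx.1, hx.2, ?_⟩
  have key : ∀ y, y ∈ s → G.Adj x y → G.dist r x = G.dist r y + 1 := by
    intro y hy hxy
    rcases aux_F1 hT r hxy with h | h
    · exact h
    · have := hmax y ⟨hy, aux_anc_of_adj hT r hx.2 hxy h⟩
      omega
  rw [Finset.card_le_one]
  intro a ha b hb
  simp only [Finset.mem_filter] at ha hb
  exact aux_F2 hT r ha.2.symm hb.2.symm (key a ha.1 ha.2) (key b hb.1 hb.2)

theorem aux_C {V : Type} [DecidableEq V] {G : SimpleGraph V} (hT : G.IsTree) (r : V) (s : Finset V)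
    (hs : (G.induce (s : Set V)).Connected) (t : V) (ht : t ∈ s)
    (hmin : ∀ v ∈ s, G.dist r t ≤ G.dist r v) (hl : leavesCnt G s t = 1)
    (u v : V) (hu : u ∈ s) (hv : v ∈ s) (hd : G.dist r u = G.dist r v) : u = v := by
  by_cases hut : u = t
  · by_contra hne
    obtain ⟨p, hp, _, h⟩ := aux_F3 hT r s hs t ht hmin v hv (by rintro rfl; exact hne hut)
    have := hmin p hp
    subst hut
    omega
  by_cases hvt : v = t
  · obtain ⟨p, hp, _, h⟩ := aux_F3 hT r s hs t ht hmin u hu hut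
    have := hmin p hp
    subst hvt
    omega
  have main : ∀ w ∈ s, w ≠ t → ∃ x, x ∈ s ∧ IsAnc G r w x ∧ x ≠ t ∧
      (s.filter fun y => G.Adj x y).card ≤ 1 := by
    intro w hw hwt
    obtain ⟨x, hx, ha, hc⟩ := aux_leaf hT r s w hw
    refine ⟨x, hx, ha, ?_, hc⟩
    rintro rfl
    obtain ⟨p, hp, _, h⟩ := aux_F3 hT r s hs x ht hmin w hw hwt
    have := hmin p hp
    unfold IsAnc at ha
    omega
  obtain ⟨x, hx, hax, hxt, hxc⟩ := main u hu hut
  obtain ⟨y, hy, hay, hyt, hyc⟩ := main v hv hvt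
  unfold leavesCnt at hl
  have hxy : x = y := by
    apply Finset.card_le_one.1 hl.le
    · simp only [Finset.mem_filter]; exact ⟨hx, hxt, by convert hxc⟩
    · simp only [Finset.mem_filter]; exact ⟨hy, hyt, by convert hyc⟩
  subst hxy
  exact aux_anc_uniq hT r hax hay hd

theorem aux_load_mono {V : Type} {n : ℕ} (G : SimpleGraph V) (S : Fin n → Finset V)
    {U W : Finset (Fin n)} (h : U ⊆ W) (o : Object V) : load G S U o ≤ load G S W o :=
  Finset.card_le_card (Finset.filter_subset_filter _ h)

theorem aux_greedy {V : Type} {n : ℕ} (G : SimpleGraph V) (S : Fin n → Finset V)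
    (k : Object V → ℕ)
    (key : ∀ m : Fin n, ∀ F : Finset (Fin n), (∀ j ∈ F, m < j) → F.Nonempty →
      ∃ j ∈ F, ∀ j' ∈ F, ∀ o, ContainsObj G (S m) o → ContainsObj G (S j') o →
        ContainsObj G (S j) o)
    (OPT : Finset (Fin n)) (hOPTfeas : Feasible G S k OPT)
    (hOPTmax : ∀ U : Finset (Fin n), Feasible G S k U → U.card ≤ OPT.card) (m : ℕ) (hm : m ≤ n) :
    ∃ O : Finset (Fin n), Feasible G S k O ∧ O.card = OPT.card ∧ greedy G S k m ⊆ O ∧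
      (∀ j ∈ greedy G S k m, (j : ℕ) < m) ∧
      ∀ j ∈ O, (j : ℕ) < m → j ∈ greedy G S k m := by
  induction m with
  | zero => exact ⟨OPT, hOPTfeas, rfl, by simp [greedy], by simp [greedy], by simp⟩
  | succ m ih =>
    obtain ⟨O, hf, hc, hsub, hlt, hback⟩ := ih (by omega)
    have hmn : m < n := hm
    set A := greedy G S k m with hA
    by_cases hins : Feasible G S k (insert ⟨m, hmn⟩ A)
    · have hg : greedy G S k (m+1) = insert ⟨m, hmn⟩ A := by
        rw [greedy, dif_pos hmn, if_pos hins]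
      rw [hg]
      have hlt' : ∀ j ∈ insert (⟨m, hmn⟩ : Fin n) A, (j : ℕ) < m + 1 := by
        intro j hj
        rcases Finset.mem_insert.1 hj with rfl | hj
        · simp
        · have := hlt j hj; omega
      by_cases hmO : (⟨m, hmn⟩ : Fin n) ∈ O
      · refine ⟨O, hf, hc, Finset.insert_subset hmO hsub, hlt', ?_⟩
        intro j hj hjm
        rw [Finset.mem_insert]
        by_cases h : (j : ℕ) = m
        · left; exact Fin.ext h
        · right; exact hback j hj (by omega)
      have hsplit : ∀ j ∈ O, j ∈ A ∨ (⟨m, hmn⟩ : Fin n) < j := by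
        intro j hj
        rcases lt_trichotomy (j : ℕ) m with h | h | h
        · exact Or.inl (hback j hj h)
        · exfalso; apply hmO; convert hj; exact h.symm
        · exact Or.inr h
      by_cases hF : (O.filter fun j => (⟨m, hmn⟩ : Fin n) < j).Nonempty
      · obtain ⟨j, hj, hjmax⟩ := key ⟨m, hmn⟩ _ (fun j hj => (Finset.mem_filter.1 hj).2) hF
        obtain ⟨hjO, hmj⟩ := Finset.mem_filter.1 hj
        have hmE : (⟨m, hmn⟩ : Fin n) ∉ O.erase j := fun h => hmO (Finset.mem_of_mem_erase h)
        refine ⟨insert ⟨m, hmn⟩ (O.erase j), ?_, ?_, ?_, hlt', ?_⟩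
        · intro o
          by_cases hom : ContainsObj G (S ⟨m, hmn⟩) o
          · by_cases hoj : ContainsObj G (S j) o
            · refine le_trans ?_ (hf o)
              unfold load
              rw [Finset.filter_insert, if_pos hom, Finset.filter_erase]
              refine (Finset.card_insert_le _ _).trans ?_
              rw [Finset.card_erase_add_one]
              exact Finset.mem_filter.2 ⟨hjO, hoj⟩
            · refine le_trans ?_ (hins o)
              unfold load
              apply Finset.card_le_card
              intro i hi
              obtain ⟨hi1, hi2⟩ := Finset.mem_filter.1 hi
              refine Finset.mem_filter.2 ⟨?_, hi2⟩
              rcases Finset.mem_insert.1 hi1 with h | h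
              · exact Finset.mem_insert.2 (Or.inl h)
              · have hiO := Finset.mem_of_mem_erase h
                rcases hsplit i hiO with h' | h'
                · exact Finset.mem_insert.2 (Or.inr h')
                · exact absurd (hjmax i (Finset.mem_filter.2 ⟨hiO, h'⟩) o hom hi2) hoj
          · refine le_trans ?_ (hf o)
            unfold load
            rw [Finset.filter_insert, if_neg hom]
            exact Finset.card_le_card (Finset.filter_subset_filter _ (Finset.erase_subset _ _))
        · rw [Finset.card_insert_of_notMem hmE, Finset.card_erase_add_one hjO, hc]
        · apply Finset.insert_subset_insert
          intro i hi
          refine Finset.mem_erase.2 ⟨?_, hsub hi⟩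
          rintro rfl
          have h1 := hlt i hi
          have h2 : m < (i : ℕ) := hmj
          omega
        · intro i hi him
          rcases Finset.mem_insert.1 hi with h | h
          · exact Finset.mem_insert.2 (Or.inl h)
          · rcases hsplit i (Finset.mem_of_mem_erase h) with h' | h'
            · exact Finset.mem_insert.2 (Or.inr h')
            · have h2 : m < (i : ℕ) := h'
              omega
      · exfalso
        have hOA : O ⊆ A := by
          intro j hj
          rcases hsplit j hj with h | h
          · exact h
          · exact absurd ⟨j, Finset.mem_filter.2 ⟨hj, h⟩⟩ hF
        have h1 := hOPTmax _ hins
        have h2 : (⟨m, hmn⟩ : Fin n) ∉ A := fun h => hmO (hsub h)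
        rw [Finset.card_insert_of_notMem h2] at h1
        have h3 := Finset.card_le_card hOA
        omega
    · have hg : greedy G S k (m+1) = A := by
        rw [greedy, dif_pos hmn, if_neg hins]
      rw [hg]
      refine ⟨O, hf, hc, hsub, fun j hj => by have := hlt j hj; omega, ?_⟩
      intro j hj hjm
      by_cases h : (j : ℕ) = m
      · exfalso
        apply hins
        intro o
        refine le_trans (aux_load_mono G S ?_ o) (hf o)
        refine Finset.insert_subset ?_ hsub
        convert hj
        exact h.symm
      · exact hback j hj (by omega)

/-- **Theorem (optimality for directed paths).** If every subtree has exactly one leaf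
other than its root (i.e. every subtree is a directed root-to-leaf path of the rooted
tree), then the greedy solution is optimal: `|ALG| = |OPT|`. -/
theorem statement3
    {V : Type} [Fintype V] [DecidableEq V] (G : SimpleGraph V)
    (hTree : G.IsTree) (r : V)
    {n : ℕ} (S : Fin n → Finset V)
    -- each `S i` is (the vertex set of) a subtree, i.e. a connected subgraph of `G`
    (hsub : ∀ i, (G.induce (S i : Set V)).Connected)
    -- `rt i` is the vertex of the subtree `S i` closest to the root `r`
    (rt : Fin n → V) (hrtmem : ∀ i, rt i ∈ S i)
    (hrtmin : ∀ i, ∀ v ∈ S i, G.dist r (rt i) ≤ G.dist r v)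
    -- `pos` is a post-order (bottom-up) traversal of the tree ...
    (pos : V → ℕ) (hposinj : Function.Injective pos)
    (hpost : ∀ u v : V, IsAnc G r v u → pos u ≤ pos v)
    (hcontig : ∀ u x v : V, IsAnc G r v u → pos u ≤ pos x → pos x ≤ pos v → IsAnc G r v x)
    -- ... along which the roots of the subtrees appear in nondecreasing order
    (hord : ∀ i j : Fin n, i ≤ j → pos (rt i) ≤ pos (rt j))
    (k : Object V → ℕ)
    -- every subtree is a directed path: it has exactly one leaf other than its root
    (hpaths : ∀ i, leavesCnt G (S i) (rt i) = 1)
    -- `OPT` is a feasible subset of maximum cardinality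
    (OPT : Finset (Fin n)) (hOPTfeas : Feasible G S k OPT)
    (hOPTmax : ∀ U : Finset (Fin n), Feasible G S k U → U.card ≤ OPT.card) :
    (greedy G S k n).card = OPT.card := by
  have ha : ∀ i j : Fin n, i ≤ j → ∀ d : ℕ, ∀ u, u ∈ S i → u ∈ S j → G.dist r u = d →
      ∀ v ∈ S i, G.dist r v ≤ d → v ∈ S j := by
    intro i j hij d
    induction d with
    | zero =>
      intro u hui huj hd v hv hvd
      have := aux_C hTree r (S i) (hsub i) (rt i) (hrtmem i) (hrtmin i) (hpaths i) u v hui hv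
        (by omega)
      exact this ▸ huj
    | succ d ih =>
      intro u hui huj hd v hv hvd
      by_cases hvd' : G.dist r v = d + 1
      · have := aux_C hTree r (S i) (hsub i) (rt i) (hrtmem i) (hrtmin i) (hpaths i) u v hui hv
          (by omega)
        exact this ▸ huj
      have hui' : u ≠ rt i := by
        rintro rfl
        have := hrtmin i v hv
        omega
      have huj' : u ≠ rt j := by
        intro h
        have h1 := hpost u (rt i)
          (aux_anc_rt hTree r (S i) (hsub i) (rt i) (hrtmem i) (hrtmin i) _ u hui rfl)
        have h2 := hord i j hij
        rw [← h] at h2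
        exact hui' (hposinj (le_antisymm h1 h2))
      obtain ⟨p, hp, hpa, hpd⟩ := aux_F3 hTree r (S i) (hsub i) (rt i) (hrtmem i) (hrtmin i) u hui hui'
      obtain ⟨q, hq, hqa, hqd⟩ := aux_F3 hTree r (S j) (hsub j) (rt j) (hrtmem j) (hrtmin j) u huj huj'
      have hpq : p = q := aux_F2 hTree r hpa hqa hpd hqd
      exact ih p hp (hpq ▸ hq) (by omega) v hv (by omega)
  have key : ∀ m : Fin n, ∀ F : Finset (Fin n), (∀ j ∈ F, m < j) → F.Nonempty →
      ∃ j ∈ F, ∀ j' ∈ F, ∀ o, ContainsObj G (S m) o → ContainsObj G (S j') o →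
        ContainsObj G (S j) o := by
    intro m F hF hne
    obtain ⟨j, hj, hmax⟩ := Finset.exists_max_image F
      (fun j => ((S m).filter fun v => v ∈ S j).card) hne
    have hv : ∀ j' ∈ F, ∀ v, v ∈ S m → v ∈ S j' → v ∈ S j := by
      intro j' hj' v hvm hvj'
      by_contra hvj
      have hlt : ((S m).filter fun v => v ∈ S j).card < ((S m).filter fun v => v ∈ S j').card := by
        apply Finset.card_lt_card
        rw [Finset.ssubset_iff_of_subset]
        · exact ⟨v, Finset.mem_filter.2 ⟨hvm, hvj'⟩, fun h => hvj (Finset.mem_filter.1 h).2⟩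
        · intro w hw
          obtain ⟨hwm, hwj⟩ := Finset.mem_filter.1 hw
          refine Finset.mem_filter.2 ⟨hwm, ?_⟩
          rcases le_total (G.dist r w) (G.dist r v) with h | h
          · exact ha m j' (hF j' hj').le _ v hvm hvj' rfl w hwm h
          · exact absurd (ha m j (hF j hj).le _ w hwm hwj rfl v hvm h) hvj
      exact absurd (hmax j' hj') (not_le.2 hlt)
    refine ⟨j, hj, ?_⟩
    intro j' hj' o hom hoj'
    cases o with
    | inl v => exact hv j' hj' v hom hoj'
    | inr e => exact ⟨hom.1, fun x hx => hv j' hj' x (hom.2 x hx) (hoj'.2 x hx)⟩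
  obtain ⟨O, _, hc, hsubO, _, hback⟩ := aux_greedy G S k key OPT hOPTfeas hOPTmax n le_rfl
  rw [← hc]
  congr 1
  exact Finset.Subset.antisymm hsubO (fun j hj => hback j hj j.2)
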